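/- Decomposition of a fractal measure into smooth and Fourier-small parts: Let μ be a probability measure on ℝⁿ supported in [−1/16, 1/16]ⁿ satisfying μ(B(x,r)) ≤ D rᵅ for all x, r > 0, and |μ̂(ξ)| ≤ D_α (1+|ξ|)^{−β/2}, where D_α ≲ (n−α)^{−O(1)}. Then there is a constant C₁ depending only on n and D and a decomposition μ = μ₁ + μ₂ where μ₁ = f dx with f smooth, compactly supported in [−1/8,1/8]ⁿ, 0 ≤ f ≤ C₁, ∫f = 1, and |μ̂_i| ≤ 2|μ̂| for i ∈ {1,2}, and ‖μ̂₂‖_∞ ≲ (n−α)^{−O(1)} exp(−(β/(2+β)) · 1/(n−α)). -/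

import Mathlib

open MeasureTheory Real

/-- The convolution `μ * φ` of a measure with a function. -/
noncomputable def mollification {E : Type*} [AddGroup E] [MeasurableSpace E] (μ : Measure E)
    (φ : E → ℝ) (x : E) : ℝ :=
  ∫ y, φ (x - y) ∂μ

/-- The kernel `e^{-2πi ξ·x}` of the Fourier transform. -/
noncomputable def fourierKernel {n : ℕ} (ξ x : EuclideanSpace ℝ (Fin n)) : ℂ :=
  Complex.exp (-(2 * (π : ℂ) * Complex.I) * ∑ i, (ξ i : ℂ) * (x i : ℂ))

section Kernel

variable {n : ℕ} (ξ x y : EuclideanSpace ℝ (Fin n))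

theorem fourierKernel_eq_exp_inner :
    fourierKernel ξ x = Complex.exp (Complex.I * ((-(2 * π * inner ℝ ξ x) : ℝ) : ℂ)) := by
  unfold fourierKernel
  congr 1
  simp only [PiLp.inner_apply, RCLike.inner_apply, conj_trivial]
  push_cast
  simp only [mul_comm (Complex.ofReal (x _))]
  ring

theorem norm_fourierKernel : ‖fourierKernel ξ x‖ = 1 := by
  rw [fourierKernel_eq_exp_inner, mul_comm, Complex.norm_exp_ofReal_mul_I]

theorem fourierKernel_add :
    fourierKernel ξ (x + y) = fourierKernel ξ x * fourierKernel ξ y := by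
  simp only [fourierKernel_eq_exp_inner, ← Complex.exp_add, inner_add_right]
  congr 1
  push_cast
  ring

theorem fourierKernel_zero : fourierKernel 0 x = 1 := by
  simp [fourierKernel]

theorem norm_one_sub_fourierKernel_le : ‖1 - fourierKernel ξ x‖ ≤ 2 * π * (‖ξ‖ * ‖x‖) := by
  rw [norm_sub_rev, fourierKernel_eq_exp_inner]
  refine Real.norm_exp_I_mul_ofReal_sub_one_le.trans ?_
  rw [norm_neg, norm_mul, Real.norm_of_nonneg (by positivity)]
  gcongr
  exact norm_inner_le_norm ξ x

theorem continuous_fourierKernel : Continuous (fourierKernel ξ) := by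
  unfold fourierKernel
  fun_prop

end Kernel

section Mollification

variable {n : ℕ} {μ : Measure (EuclideanSpace ℝ (Fin n))}
  {φ : EuclideanSpace ℝ (Fin n) → ℝ}

theorem contDiff_mollification [IsFiniteMeasure μ] (hφ : ContDiff ℝ (⊤ : ℕ∞) φ)
    (hc : HasCompactSupport φ) :
    ContDiff ℝ (⊤ : ℕ∞) (mollification μ φ) := by
  have h := hc.contDiff_convolution_right (ContinuousLinearMap.mul ℝ ℝ)
    (locallyIntegrable_const (μ := μ) (1 : ℝ)) hφ
  have heq : mollification μ φ =
      convolution (fun _ => (1 : ℝ)) φ (ContinuousLinearMap.mul ℝ ℝ) μ := by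
    ext x
    simp [mollification, convolution]
  rwa [heq]

/-- The Fourier transform turns the convolution `μ * φ` into a product. -/
theorem integral_mollification_mul_fourierKernel [IsFiniteMeasure μ] (hφ : Integrable φ)
    (ξ : EuclideanSpace ℝ (Fin n)) :
    ∫ x, (mollification μ φ x : ℂ) * fourierKernel ξ x =
      (∫ y, fourierKernel ξ y ∂μ) * ∫ u, (φ u : ℂ) * fourierKernel ξ u := by
  have hint : Integrable (fun p : EuclideanSpace ℝ (Fin n) × EuclideanSpace ℝ (Fin n) =>
      (φ (p.1 - p.2) : ℂ) * fourierKernel ξ p.1) (volume.prod μ) := by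
    have h := (integrable_const (μ := μ) (1 : ℝ)).convolution_integrand
      (ContinuousLinearMap.mul ℝ ℝ) hφ
    simp only [ContinuousLinearMap.mul_apply', one_mul] at h
    refine h.ofReal.mul_bdd (c := 1) ?_ ?_
    · exact ((continuous_fourierKernel ξ).comp continuous_fst).aestronglyMeasurable
    · exact .of_forall fun p => (norm_fourierKernel ξ p.1).le
  calc ∫ x, (mollification μ φ x : ℂ) * fourierKernel ξ x
      = ∫ x, ∫ y, (φ (x - y) : ℂ) * fourierKernel ξ x ∂μ := by
        simp only [mollification, integral_mul_const, integral_complex_ofReal]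
    _ = ∫ y, (∫ x, (φ (x - y) : ℂ) * fourierKernel ξ x) ∂μ := integral_integral_swap hint
    _ = ∫ y, fourierKernel ξ y * (∫ u, (φ u : ℂ) * fourierKernel ξ u) ∂μ := by
        congr 1 with y
        rw [← integral_add_right_eq_self _ y, ← integral_const_mul]
        congr 1 with u
        rw [add_sub_cancel_right, fourierKernel_add]
        ring
    _ = _ := integral_mul_const _ _

theorem mollification_le [IsFiniteMeasure μ] {K R B : ℝ} (hφ₀ : ∀ x, 0 ≤ φ x)
    (hφK : ∀ x, φ x ≤ K)
    (hφR : Function.support φ ⊆ Metric.closedBall 0 R) (hK : 0 ≤ K)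
    (x : EuclideanSpace ℝ (Fin n)) (hB : 0 ≤ B)
    (hμ : μ (Metric.closedBall x R) ≤ ENNReal.ofReal B) :
    mollification μ φ x ≤ K * B := by
  calc mollification μ φ x
      ≤ ∫ y, (Metric.closedBall x R).indicator (fun _ => K) y ∂μ := by
        refine integral_mono_of_nonneg (.of_forall fun y => hφ₀ _)
          ((integrable_const K).indicator measurableSet_closedBall) (.of_forall fun y => ?_)
        by_cases hy : y ∈ Metric.closedBall x R
        · simpa [hy] using hφK (x - y)
        · have : φ (x - y) = 0 := by
            by_contra h
            exact hy (by simpa [dist_eq_norm, norm_sub_rev] using hφR h)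
          simp [hy, this]
    _ = K * μ.real (Metric.closedBall x R) := by
        rw [integral_indicator_const _ measurableSet_closedBall, smul_eq_mul, mul_comm]
    _ ≤ K * B := by
        gcongr
        exact ENNReal.toReal_le_of_le_ofReal hB hμ

theorem support_mollification_subset {a R : ℝ}
    (hμ : μ {x : EuclideanSpace ℝ (Fin n) | ¬ ∀ i, |x i| ≤ a} = 0)
    (hφR : Function.support φ ⊆ Metric.closedBall 0 R) :
    Function.support (mollification μ φ) ⊆
      {x : EuclideanSpace ℝ (Fin n) | ∀ i, |x i| ≤ a + R} := by
  intro x hx i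
  by_contra! hi
  refine hx (integral_eq_zero_of_ae ?_)
  have hμ' : ∀ᵐ y ∂μ, ∀ i, |y i| ≤ a := hμ
  filter_upwards [hμ'] with y hy
  by_contra h
  have hxy : ‖x - y‖ ≤ R := by simpa using hφR h
  have h1 : |x i - y i| ≤ ‖x - y‖ := by simpa using PiLp.norm_apply_le (x - y) i
  have h2 := abs_sub_abs_le_abs_sub (x i) (y i)
  linarith [hy i]

theorem norm_integral_mul_fourierKernel_le (hφ₀ : ∀ x, 0 ≤ φ x) (hφ : ∫ x, φ x = 1)
    (ξ : EuclideanSpace ℝ (Fin n)) : ‖∫ u, (φ u : ℂ) * fourierKernel ξ u‖ ≤ 1 := by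
  refine (norm_integral_le_integral_norm _).trans_eq ?_
  simp [norm_fourierKernel, abs_of_nonneg (hφ₀ _), hφ]

theorem norm_one_sub_integral_mul_fourierKernel_le {R : ℝ} (hφ₀ : ∀ x, 0 ≤ φ x)
    (hφi : Integrable φ) (hφ : ∫ x, φ x = 1)
    (hφR : Function.support φ ⊆ Metric.closedBall 0 R) (ξ : EuclideanSpace ℝ (Fin n)) :
    ‖1 - ∫ u, (φ u : ℂ) * fourierKernel ξ u‖ ≤ 2 * π * (‖ξ‖ * R) := by
  have h1 : (1 : ℂ) = ∫ u, (φ u : ℂ) := by rw [integral_complex_ofReal, hφ, Complex.ofReal_one]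
  have hi : Integrable fun u => (φ u : ℂ) * fourierKernel ξ u :=
    hφi.ofReal.mul_bdd (c := 1) (continuous_fourierKernel ξ).aestronglyMeasurable
      (.of_forall fun p => (norm_fourierKernel ξ p).le)
  have hφi' : Integrable fun u => (φ u : ℂ) := hφi.ofReal
  rw [h1, ← integral_sub hφi' hi]
  calc _ ≤ ∫ u, φ u * (2 * π * (‖ξ‖ * R)) := by
        refine norm_integral_le_of_norm_le (hφi.mul_const _) (.of_forall fun u => ?_)
        rw [← mul_one_sub, norm_mul, Complex.norm_real, Real.norm_of_nonneg (hφ₀ u)]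
        by_cases hu : φ u = 0
        · simp [hu]
        · have : ‖u‖ ≤ R := by simpa using hφR hu
          exact mul_le_mul_of_nonneg_left
            ((norm_one_sub_fourierKernel_le ξ u).trans (by gcongr)) (hφ₀ u)
    _ = _ := by rw [integral_mul_const, hφ, one_mul]

end Mollification

/-- Normalised smooth bumps of radius `R` whose sup norm is controlled by `R⁻ⁿ`. -/
theorem exists_smooth_bump_le {n : ℕ} {R : ℝ} (hR : 0 < R) :
    ∃ φ : EuclideanSpace ℝ (Fin n) → ℝ, ContDiff ℝ (⊤ : ℕ∞) φ ∧ HasCompactSupport φ ∧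
      Function.support φ ⊆ Metric.closedBall 0 R ∧ (∀ x, 0 ≤ φ x) ∧ ∫ x, φ x = 1 ∧
      ∀ x, φ x ≤ 2 ^ n /
        (R ^ n * volume.real (Metric.ball (0 : EuclideanSpace ℝ (Fin n)) 1)) := by
  let b : ContDiffBump (0 : EuclideanSpace ℝ (Fin n)) := ⟨R / 2, R, by positivity, by linarith⟩
  refine ⟨b.normed volume, b.contDiff_normed, b.hasCompactSupport_normed, ?_,
    b.nonneg_normed, b.integral_normed, fun x => ?_⟩
  · rw [b.support_normed_eq]
    exact Metric.ball_subset_closedBall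
  · have h := b.normed_le_div_measure_closedBall_rOut volume 2
      (by change R ≤ 2 * (R / 2); linarith) x
    rw [Measure.addHaar_real_closedBall _ _ b.rOut_pos.le, finrank_euclideanSpace_fin] at h
    exact h

/-- Frequencies below the threshold `L ^ (2 / (2 + β))` are controlled by `t / L`, the others by
the decay `(1 + t) ^ (-(β / 2))`. -/
theorem rpow_neg_mul_min_le {β L t : ℝ} (hβ : 0 < β) (hL : 0 < L) (ht : 0 ≤ t) :
    (1 + t) ^ (-(β / 2)) * min 2 (t / L) ≤ 2 * L ^ (-(β / (2 + β))) := by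
  have hdecay : (1 + t) ^ (-(β / 2)) ≤ 1 :=
    Real.rpow_le_one_of_one_le_of_nonpos (by linarith) (by linarith)
  have hpos : 0 < L ^ (-(β / (2 + β))) := Real.rpow_pos_of_pos hL _
  rcases le_total t (L ^ (2 / (2 + β))) with h | h
  · calc (1 + t) ^ (-(β / 2)) * min 2 (t / L) ≤ 1 * (L ^ (2 / (2 + β)) / L) := by
          gcongr
          exact (min_le_right _ _).trans (by gcongr)
      _ = L ^ (-(β / (2 + β))) := by
          rw [one_mul, ← Real.rpow_sub_one hL.ne']
          congr 1
          field_simp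
          ring
      _ ≤ _ := by linarith
  · calc (1 + t) ^ (-(β / 2)) * min 2 (t / L) ≤ (L ^ (2 / (2 + β))) ^ (-(β / 2)) * 2 := by
          refine mul_le_mul ?_ (min_le_left _ _) (by positivity) (by positivity)
          exact Real.rpow_le_rpow_of_nonpos (by positivity) (by linarith) (by linarith)
      _ = 2 * L ^ (-(β / (2 + β))) := by
          rw [← Real.rpow_mul hL.le, mul_comm]
          congr 2
          field_simp

/-- Decomposition of a fractal measure into a smooth part and a Fourier-small part:
for a probability measure `μ` on `ℝⁿ` supported in `[−1/16,1/16]ⁿ` with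
`μ(B(x,r)) ≤ D rᵅ` and `|μ̂(ξ)| ≤ D_α (1+|ξ|)^{−β/2}` where `D_α ≤ C₀(n−α)^{−M}`,
there exist a constant `C₁` (depending only on `n, D`) and a smooth `f ≥ 0` supported in
`[−1/8,1/8]ⁿ` with `f ≤ C₁`, `∫ f = 1`, such that writing `μ₁ = f dx` and `μ₂ = μ − μ₁`,
both `|μ̂_i| ≤ 2|μ̂|` and `‖μ̂₂‖_∞ ≲ (n−α)^{−O(1)} exp(−(β/(2+β))·1/(n−α))`. -/
theorem fractal_measure_decomposition (n : ℕ) (hn : 0 < n) (D : ℝ) (hD : 1 ≤ D) :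
    ∃ C₁ : ℝ, 0 < C₁ ∧
    ∀ C₀ M : ℝ, 0 < C₀ → 0 ≤ M →
    ∃ C₂ M₂ : ℝ, 0 < C₂ ∧ 0 ≤ M₂ ∧
    ∀ (α β Dα : ℝ) (μ : Measure (EuclideanSpace ℝ (Fin n))), IsProbabilityMeasure μ →
      0 < β → β ≤ α → α < n →
      μ {x : EuclideanSpace ℝ (Fin n) | ¬ ∀ i, |x i| ≤ 1 / 16} = 0 →
      (∀ (x : EuclideanSpace ℝ (Fin n)) (r : ℝ), 0 < r →
        μ (Metric.closedBall x r) ≤ ENNReal.ofReal (D * r ^ α)) →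
      Dα ≤ C₀ * ((n : ℝ) - α) ^ (-M) →
      ∀ μhat : EuclideanSpace ℝ (Fin n) → ℂ,
        (∀ ξ, μhat ξ = ∫ x, Complex.exp
            (-(2 * (π : ℂ) * Complex.I) * ∑ i, (ξ i : ℂ) * (x i : ℂ)) ∂μ) →
        (∀ ξ, ‖μhat ξ‖ ≤ Dα * (1 + ‖ξ‖) ^ (-(β / 2))) →
      ∃ f : EuclideanSpace ℝ (Fin n) → ℝ,
        ContDiff ℝ (⊤ : ℕ∞) f ∧ HasCompactSupport f ∧
        (Function.support f ⊆ {x : EuclideanSpace ℝ (Fin n) | ∀ i, |x i| ≤ 1 / 8}) ∧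
        (∀ x, 0 ≤ f x) ∧ (∀ x, f x ≤ C₁) ∧ (∫ x, f x = 1) ∧
        ∀ fhat : EuclideanSpace ℝ (Fin n) → ℂ,
          (∀ ξ, fhat ξ = ∫ x, (f x : ℂ) * Complex.exp
              (-(2 * (π : ℂ) * Complex.I) * ∑ i, (ξ i : ℂ) * (x i : ℂ))) →
          ((∀ ξ, ‖fhat ξ‖ ≤ 2 * ‖μhat ξ‖) ∧
           (∀ ξ, ‖μhat ξ - fhat ξ‖ ≤ 2 * ‖μhat ξ‖) ∧
           (∀ ξ, ‖μhat ξ - fhat ξ‖ ≤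
              C₂ * ((n : ℝ) - α) ^ (-M₂) *
                Real.exp (-(β / (2 + β)) * (1 / ((n : ℝ) - α))))) := by
  set v : ℝ := volume.real (Metric.ball (0 : EuclideanSpace ℝ (Fin n)) 1)
  have hvpos : 0 < v := ENNReal.toReal_pos
    (Metric.measure_ball_pos volume _ one_pos).ne' measure_ball_lt_top.ne
  refine ⟨2 ^ n * 16 ^ n / v * (D * exp 1), by positivity, fun C₀ M hC₀ hM =>
    ⟨2 * C₀, M, by positivity, hM, ?_⟩⟩
  intro α β Dα μ _ hβ hβα hαn hsupp hball hDα μhat hμhat hdecay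
  have hnα : 0 < (n : ℝ) - α := sub_pos.2 hαn
  set L : ℝ := exp (1 / ((n : ℝ) - α)) with hLdef
  have hL : 0 < L := exp_pos _
  have hL1 : 1 ≤ L := one_le_exp (by positivity)
  have hR : 0 < 1 / (16 * L) := by positivity
  have hR16 : 1 / (16 * L) ≤ 1 / 16 := by gcongr; linarith
  obtain ⟨φ, hφs, hφc, hφR, hφ₀, hφ1, hφK⟩ := exists_smooth_bump_le (n := n) hR
  have hφi : Integrable φ := hφs.continuous.integrable_of_hasCompactSupport hφc
  have hsub : Function.support (mollification μ φ) ⊆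
      {x : EuclideanSpace ℝ (Fin n) | ∀ i, |x i| ≤ 1 / 8} := fun x hx i =>
    (support_mollification_subset hsupp hφR hx i).trans (by linarith)
  have hf₀ : ∀ x, 0 ≤ mollification μ φ x := fun x => integral_nonneg fun y => hφ₀ _
  have hfourier := integral_mollification_mul_fourierKernel (μ := μ) hφi
  refine ⟨mollification μ φ, contDiff_mollification hφs hφc, ?_, hsub, hf₀, fun x => ?_, ?_, ?_⟩
  · refine HasCompactSupport.of_support_subset_isCompact
      (isCompact_closedBall 0 (√n * (1 / 8))) (hsub.trans fun x hx => ?_)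
    rw [mem_closedBall_zero_iff, EuclideanSpace.norm_eq]
    refine Real.sqrt_le_iff.2 ⟨by positivity, ?_⟩
    rw [mul_pow, Real.sq_sqrt n.cast_nonneg]
    calc ∑ i, ‖x i‖ ^ 2 ≤ ∑ _i : Fin n, (1 / 8 : ℝ) ^ 2 := by
          gcongr with i
          exact hx i
      _ = _ := by simp
  · refine (mollification_le hφ₀ hφK hφR (by positivity) x (by positivity)
      (hball x _ hR)).trans ?_
    have h1 : (1 / (16 * L)) ^ α ≤ L ^ (-α) := by
      rw [one_div, Real.inv_rpow (by positivity), ← Real.rpow_neg (by positivity)]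
      exact Real.rpow_le_rpow_of_nonpos hL (by linarith) (by linarith)
    have h2 : L ^ n * L ^ (-α) = exp 1 := by
      rw [← Real.rpow_natCast, ← Real.rpow_add hL, hLdef, ← Real.exp_mul]
      congr 1
      field_simp
      ring
    calc _ ≤ 2 ^ n / ((1 / (16 * L)) ^ n * v) * (D * L ^ (-α)) := by gcongr
      _ = 2 ^ n * 16 ^ n / v * (D * (L ^ n * L ^ (-α))) := by
          rw [one_div, inv_pow, mul_pow]
          field_simp
      _ = _ := by rw [h2]
  · have h := hfourier 0
    simp only [fourierKernel_zero, mul_one, integral_complex_ofReal, hφ1] at h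
    simpa using h
  · intro fhat hfhat
    have hprod : ∀ ξ, fhat ξ = μhat ξ * ∫ u, (φ u : ℂ) * fourierKernel ξ u := fun ξ => by
      rw [hfhat, hμhat]
      exact hfourier ξ
    have hφhat := norm_integral_mul_fourierKernel_le hφ₀ hφ1
    have hdiff : ∀ ξ, ‖μhat ξ - fhat ξ‖ =
        ‖μhat ξ‖ * ‖1 - ∫ u, (φ u : ℂ) * fourierKernel ξ u‖ := fun ξ => by
      rw [hprod, ← mul_one_sub, norm_mul]
    have htwo : ∀ ξ, ‖1 - ∫ u, (φ u : ℂ) * fourierKernel ξ u‖ ≤ 2 := fun ξ =>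
      (norm_sub_le _ _).trans (by rw [norm_one]; linarith [hφhat ξ])
    refine ⟨fun ξ => ?_, fun ξ => ?_, fun ξ => ?_⟩
    · rw [hprod, norm_mul, mul_comm]
      gcongr
      linarith [hφhat ξ]
    · rw [hdiff, mul_comm]
      gcongr
      exact htwo ξ
    · have hmin : ‖1 - ∫ u, (φ u : ℂ) * fourierKernel ξ u‖ ≤ min 2 (‖ξ‖ / L) := by
        refine le_min (htwo ξ) ((norm_one_sub_integral_mul_fourierKernel_le hφ₀ hφi hφ1 hφR
          ξ).trans ?_)
        calc 2 * π * (‖ξ‖ * (1 / (16 * L))) = π / 8 * (‖ξ‖ / L) := by field_simp; ring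
          _ ≤ 1 * (‖ξ‖ / L) := by
              gcongr
              linarith [pi_le_four]
          _ = _ := one_mul _
      have hLexp : L ^ (-(β / (2 + β))) = exp (-(β / (2 + β)) * (1 / ((n : ℝ) - α))) := by
        rw [hLdef, ← Real.exp_mul, mul_comm]
      have hDα₀ : 0 ≤ C₀ * ((n : ℝ) - α) ^ (-M) := by positivity
      calc ‖μhat ξ - fhat ξ‖
          ≤ C₀ * ((n : ℝ) - α) ^ (-M) * (1 + ‖ξ‖) ^ (-(β / 2)) * min 2 (‖ξ‖ / L) := by
            rw [hdiff]
            gcongr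
            exact (hdecay ξ).trans (by gcongr)
        _ ≤ C₀ * ((n : ℝ) - α) ^ (-M) * (2 * L ^ (-(β / (2 + β)))) := by
            rw [mul_assoc]
            exact mul_le_mul_of_nonneg_left (rpow_neg_mul_min_le hβ hL (norm_nonneg ξ)) hDα₀
        _ = _ := by rw [hLexp]; ring
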